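/- arXiv:2605.03587 — 4 statements merged into one kernel-verified Lean document; each statement's English description precedes it below -/
import Mathlib

section
/- For every real number q with 0 < q < 1 and every natural number M ≥ 1, the first discrete moment of the truncated GL weights is strictly negative: S_1(q,M) < 0. -/
/-- Generalized binomial coefficient `binom(q,k) = (∏_{j=0}^{k-1} (q-j)) / k!`. -/
noncomputable def genBinom (q : ℝ) (k : ℕ) : ℝ :=
  (∏ j ∈ Finset.range k, (q - (j : ℝ))) / (Nat.factorial k : ℝ)

/-- Grünwald–Letnikov weight `w_k(q) = (-1)^k binom(q,k)`. -/
noncomputable def glWeight (q : ℝ) (k : ℕ) : ℝ :=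
  (-1 : ℝ) ^ k * genBinom q k

/-- Truncated discrete moment `S_n(q,M) = Σ_{k=0}^{M} w_k(q) k^n`. -/
noncomputable def glMoment (n : ℕ) (q : ℝ) (M : ℕ) : ℝ :=
  ∑ k ∈ Finset.range (M + 1), glWeight q k * (k : ℝ) ^ n

theorem glWeight_succ_neg (q : ℝ) (hq0 : 0 < q) (hq1 : q < 1) (k : ℕ) :
    glWeight q (k + 1) < 0 := by
  induction k with
  | zero => simpa [glWeight, genBinom] using hq0
  | succ k ih =>
    have h : glWeight q (k + 1 + 1)
        = glWeight q (k + 1) * (((k : ℝ) + 1 - q) / ((k : ℝ) + 2)) := by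
      unfold glWeight genBinom
      rw [Finset.prod_range_succ _ (k + 1), Nat.factorial_succ (k + 1), pow_succ _ (k + 1)]
      have h1 : ((k + 1).factorial : ℝ) ≠ 0 := by positivity
      have h2 : (k : ℝ) + 2 ≠ 0 := by positivity
      have h3 : (k : ℝ) + 1 + 1 ≠ 0 := by positivity
      push_cast
      rw [show (k : ℝ) + 1 + 1 = k + 2 by ring]
      field_simp
      ring
    rw [h]
    have hk : (0 : ℝ) ≤ k := Nat.cast_nonneg k
    exact mul_neg_of_neg_of_pos ih (div_pos (by linarith) (by linarith))

/-- For `0 < q < 1` and `M ≥ 1`, the first discrete moment is strictly negative. -/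
theorem glMoment_one_neg (q : ℝ) (hq0 : 0 < q) (hq1 : q < 1) (M : ℕ) (hM : 1 ≤ M) :
    glMoment 1 q M < 0 := by
  unfold glMoment
  rw [Finset.sum_range_succ']
  have h : ∑ k ∈ Finset.range M, glWeight q (k + 1) * ((k + 1 : ℕ) : ℝ) ^ 1 < 0 := by
    apply Finset.sum_neg
    · intro k _
      exact mul_neg_of_neg_of_pos (glWeight_succ_neg q hq0 hq1 k) (by positivity)
    · exact Finset.nonempty_range_iff.mpr (by omega)
  simpa using h
end

section
/- For every real number q with 0 < q < 1, the partial sums of the GL weights tend to zero as the truncation length grows: lim_{M→∞} S_0(q,M) = lim_{M→∞} Σ_{k=0}^{M} (−1)^k binom(q,k) = 0; equivalently, the infinite series Σ_{k=0}^{∞} w_k(q) converges to 0. -/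
open Filter Topology

lemma glWeight_succ_aux (q : ℝ) (k : ℕ) :
    glWeight q (k + 1) = -(q / (k + 1)) * ∏ j ∈ Finset.range k, (1 - q / ((j : ℝ) + 1)) := by
  have hrec : ∀ n : ℕ, glWeight q (n + 1) = glWeight q n * (((n : ℝ) - q) / (n + 1)) := by
    intro n
    have h1 : (n : ℝ) + 1 ≠ 0 := by positivity
    have h2 : (Nat.factorial n : ℝ) ≠ 0 := by positivity
    unfold glWeight genBinom
    rw [Finset.prod_range_succ, Nat.factorial_succ, pow_succ]
    push_cast
    field_simp
    ring
  induction k with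
  | zero => simp [glWeight, genBinom]
  | succ n ih =>
    rw [hrec (n + 1), ih, Finset.prod_range_succ]
    have h1 : (n : ℝ) + 1 ≠ 0 := by positivity
    have h2 : (n : ℝ) + 1 + 1 ≠ 0 := by positivity
    push_cast
    field_simp

lemma glSum_aux (q : ℝ) (M : ℕ) :
    ∑ k ∈ Finset.range (M + 1), glWeight q k
      = ∏ j ∈ Finset.range M, (1 - q / ((j : ℝ) + 1)) := by
  induction M with
  | zero => simp [glWeight, genBinom]
  | succ n ih =>
    rw [Finset.sum_range_succ, ih, glWeight_succ_aux, Finset.prod_range_succ]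
    ring

lemma glFactor_nonneg_aux (q : ℝ) (hq1 : q < 1) (j : ℕ) : 0 ≤ 1 - q / ((j : ℝ) + 1) := by
  have h : (0 : ℝ) < (j : ℝ) + 1 := by positivity
  rw [sub_nonneg, div_le_one h]
  have : (0 : ℝ) ≤ j := Nat.cast_nonneg j
  linarith

lemma glProd_tendsto_aux (q : ℝ) (hq0 : 0 < q) (hq1 : q < 1) :
    Tendsto (fun M : ℕ => ∏ j ∈ Finset.range M, (1 - q / ((j : ℝ) + 1))) atTop (𝓝 0) := by
  have hlim : Tendsto (fun M : ℕ => Real.exp (-(q * ∑ j ∈ Finset.range M, (1 / ((j : ℝ) + 1)))))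
      atTop (𝓝 0) :=
    Real.tendsto_exp_neg_atTop_nhds_zero.comp
      (Real.tendsto_sum_range_one_div_nat_succ_atTop.const_mul_atTop hq0)
  refine squeeze_zero (fun M => Finset.prod_nonneg fun j _ => glFactor_nonneg_aux q hq1 j)
    (fun M => ?_) hlim
  rw [Finset.mul_sum, ← Finset.sum_neg_distrib, Real.exp_sum]
  refine Finset.prod_le_prod (fun j _ => glFactor_nonneg_aux q hq1 j) fun j _ => ?_
  have := Real.add_one_le_exp (-(q * (1 / ((j : ℝ) + 1))))
  rw [mul_one_div] at this ⊢
  linarith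

/-- For `0 < q < 1`, the partial sums `S_0(q,M) = Σ_{k=0}^M w_k(q)` tend to `0` as
`M → ∞`; equivalently, the series `Σ_{k=0}^∞ w_k(q)` converges to `0`. -/
theorem glWeight_sum_tendsto_zero (q : ℝ) (hq0 : 0 < q) (hq1 : q < 1) :
    Tendsto (fun M : ℕ => glMoment 0 q M) atTop (𝓝 0) ∧
    HasSum (fun k : ℕ => glWeight q k) 0 := by
  have hS : Tendsto (fun M : ℕ => ∑ k ∈ Finset.range (M + 1), glWeight q k) atTop (𝓝 0) := by
    simp_rw [glSum_aux]
    exact glProd_tendsto_aux q hq0 hq1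
  refine ⟨by simpa [glMoment] using hS, ?_⟩
  have h0 : glWeight q 0 = 1 := by simp [glWeight, genBinom]
  have hneg : HasSum (fun k : ℕ => -glWeight q (k + 1)) 1 := by
    rw [hasSum_iff_tendsto_nat_of_nonneg]
    · have h := hS.const_sub 1
      simp_rw [Finset.sum_range_succ', h0] at h
      simpa using h
    · intro k
      rw [glWeight_succ_aux, neg_mul, neg_neg]
      exact mul_nonneg (by positivity)
        (Finset.prod_nonneg fun j _ => glFactor_nonneg_aux q hq1 j)
  have h1 : HasSum (fun k : ℕ => glWeight q (k + 1)) (-1) := by simpa using hneg.neg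
  rw [← hasSum_nat_add_iff' 1]
  simpa [h0] using h1
end

section
/- For every real number q with 0 < q < 1 and every natural number M, the series of absolute values of the discarded GL tail converges and satisfies Σ_{k=M+1}^{∞} |w_k(q)| = S_0(q,M) = (−1)^M binom(q−1, M). -/
theorem aux_P_succ (q : ℝ) (M : ℕ) : (-1 : ℝ) ^ (M+1) * genBinom (q - 1) (M+1)
    = ((-1 : ℝ) ^ M * genBinom (q - 1) M) * (1 - q / (M + 1)) := by
  have h1 : (M : ℝ) + 1 ≠ 0 := by positivity
  have h2 : (Nat.factorial M : ℝ) ≠ 0 := by positivity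
  unfold genBinom
  rw [Finset.prod_range_succ, Nat.factorial_succ]
  push_cast
  field_simp
  ring

theorem aux_w_succ (q : ℝ) (M : ℕ) : glWeight q (M + 1) = glWeight q M * ((M - q) / (M + 1)) := by
  have h1 : (M : ℝ) + 1 ≠ 0 := by positivity
  have h2 : (Nat.factorial M : ℝ) ≠ 0 := by positivity
  unfold glWeight genBinom
  rw [Finset.prod_range_succ, Nat.factorial_succ]
  push_cast
  field_simp
  ring

theorem aux_w_P (q : ℝ) (M : ℕ) :
    glWeight q (M + 1) = -(q / (M + 1)) * ((-1 : ℝ) ^ M * genBinom (q - 1) M) := by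
  induction M with
  | zero => simp [glWeight, genBinom]
  | succ M ih =>
    rw [aux_w_succ, ih, aux_P_succ]
    have h1 : (M : ℝ) + 1 ≠ 0 := by positivity
    have h2 : (M : ℝ) + 1 + 1 ≠ 0 := by positivity
    push_cast
    field_simp

theorem aux_moment (q : ℝ) (M : ℕ) :
    glMoment 0 q M = (-1 : ℝ) ^ M * genBinom (q - 1) M := by
  induction M with
  | zero => simp [glMoment, glWeight, genBinom]
  | succ M ih =>
    have : glMoment 0 q (M + 1) = glMoment 0 q M + glWeight q (M + 1) := by
      simp [glMoment, Finset.sum_range_succ _ (M + 1)]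
    rw [this, ih, aux_w_P, aux_P_succ]
    ring

theorem aux_pos (q : ℝ) (hq1 : q < 1) (M : ℕ) :
    0 < (-1 : ℝ) ^ M * genBinom (q - 1) M := by
  induction M with
  | zero => simp [genBinom]
  | succ M ih =>
    rw [aux_P_succ]
    refine mul_pos ih ?_
    have h1 : (0 : ℝ) < M + 1 := by positivity
    have h0 : (0 : ℝ) ≤ M := by positivity
    rw [sub_pos, div_lt_one h1]
    linarith

theorem aux_bound (q : ℝ) (hq0 : 0 < q) (hq1 : q < 1) (M : ℕ) :
    ((-1 : ℝ) ^ M * genBinom (q - 1) M) *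
      (1 + q * ∑ i ∈ Finset.range M, (1 / ((i : ℝ) + 1))) ≤ 1 := by
  induction M with
  | zero => simp [genBinom]
  | succ M ih =>
    rw [aux_P_succ, Finset.sum_range_succ]
    refine le_trans ?_ ih
    rw [mul_assoc]
    refine mul_le_mul_of_nonneg_left ?_ (aux_pos q hq1 M).le
    have hS : 0 ≤ ∑ i ∈ Finset.range M, (1 / ((i : ℝ) + 1)) :=
      Finset.sum_nonneg fun i _ => by positivity
    set S := ∑ i ∈ Finset.range M, (1 / ((i : ℝ) + 1))
    have ha : 0 ≤ q / ((M : ℝ) + 1) := by positivity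
    have e : q * (S + 1 / ((M : ℝ) + 1)) = q * S + q / ((M : ℝ) + 1) := by ring
    rw [e]
    have hb : 0 ≤ q * S := by positivity
    nlinarith [mul_nonneg ha hb, mul_nonneg ha ha]

theorem aux_tendsto (q : ℝ) (hq0 : 0 < q) (hq1 : q < 1) :
    Filter.Tendsto (fun M : ℕ => (-1 : ℝ) ^ M * genBinom (q - 1) M) Filter.atTop (nhds 0) := by
  have hT : Filter.Tendsto (fun M : ℕ =>
      (1 + q * ∑ i ∈ Finset.range M, (1 / ((i : ℝ) + 1)))⁻¹) Filter.atTop (nhds 0) :=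
    (Filter.tendsto_atTop_add_const_left _ _
      (Real.tendsto_sum_range_one_div_nat_succ_atTop.const_mul_atTop hq0)).inv_tendsto_atTop
  refine squeeze_zero (fun M => (aux_pos q hq1 M).le) (fun M => ?_) hT
  have hS : 0 ≤ ∑ i ∈ Finset.range M, (1 / ((i : ℝ) + 1)) :=
    Finset.sum_nonneg fun i _ => by positivity
  rw [← one_div, le_div_iff₀ (by positivity)]
  exact aux_bound q hq0 hq1 M

/-- For `0 < q < 1` and any `M`, the series of absolute values of the discarded GL tail
converges and `Σ_{k=M+1}^∞ |w_k(q)| = S_0(q,M) = (-1)^M binom(q-1, M)`. -/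
theorem glWeight_tail_abs_sum (q : ℝ) (hq0 : 0 < q) (hq1 : q < 1) (M : ℕ) :
    HasSum (fun k : ℕ => |glWeight q (M + 1 + k)|) (glMoment 0 q M) ∧
    glMoment 0 q M = (-1 : ℝ) ^ M * genBinom (q - 1) M := by
  refine ⟨?_, aux_moment q M⟩
  rw [hasSum_iff_tendsto_nat_of_nonneg (fun _ => abs_nonneg _)]
  have habs : ∀ k, |glWeight q (k + 1)| = (-1 : ℝ) ^ k * genBinom (q - 1) k
      - (-1 : ℝ) ^ (k + 1) * genBinom (q - 1) (k + 1) := by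
    intro k
    have hp := aux_pos q hq1 k
    rw [aux_w_P, aux_P_succ, abs_mul, abs_neg, abs_of_pos hp, abs_of_pos (by positivity)]
    ring
  have hsum : ∀ n : ℕ, ∑ i ∈ Finset.range n, |glWeight q (M + 1 + i)| =
      glMoment 0 q M - (-1 : ℝ) ^ (n + M) * genBinom (q - 1) (n + M) := by
    intro n
    induction n with
    | zero => simp [aux_moment]
    | succ n ih =>
      rw [Finset.sum_range_succ, ih, show M + 1 + n = n + M + 1 by ring, habs,
        show n + 1 + M = n + M + 1 by ring]
      ring
  simp_rw [hsum]
  have := ((Filter.tendsto_add_atTop_iff_nat M).2 (aux_tendsto q hq0 hq1)).const_sub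
    (glMoment 0 q M)
  simpa using this
end

section
/- For every real number q with 0 < q < 1, the GL weights decay algebraically: lim_{k→∞} k^{q+1} · |w_k(q)| = q/Γ(1−q), where Γ denotes the real Gamma function. -/
open Filter Topology

/-- Algebraic decay of the GL weights: for `0 < q < 1`,
`lim_{k→∞} k^{q+1} |w_k(q)| = q / Γ(1-q)`. -/
theorem glWeight_algebraic_decay (q : ℝ) (hq0 : 0 < q) (hq1 : q < 1) :
    Tendsto (fun k : ℕ => (k : ℝ) ^ (q + 1) * |glWeight q k|) atTop
      (𝓝 (q / Real.Gamma (1 - q))) := by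
  have hG : Real.Gamma (1 - q) = -q * Real.Gamma (-q) := by
    have := Real.Gamma_add_one (s := -q) (by linarith)
    rw [← this]; congr 1; ring
  have hpos : 0 < Real.Gamma (1 - q) := Real.Gamma_pos_of_pos (by linarith)
  have hne : Real.Gamma (-q) ≠ 0 := by
    intro h; rw [h] at hG; simp at hG; linarith
  have h1 := (Real.GammaSeq_tendsto_Gamma (-q)).inv₀ hne
  have h2 : Tendsto (fun k : ℕ => (k : ℝ) / ((k : ℝ) + (-q))) atTop (𝓝 1) :=
    tendsto_natCast_div_add_atTop (-q)
  have h3 := (h2.mul h1).abs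
  have e : |1 * (Real.Gamma (-q))⁻¹| = q / Real.Gamma (1 - q) := by
    have hneg : Real.Gamma (-q) < 0 := by
      by_contra h
      push Not at h
      nlinarith [mul_nonneg hq0.le h]
    rw [one_mul, abs_of_neg (inv_lt_zero.mpr hneg), hG]
    field_simp
  rw [e] at h3
  refine h3.congr' ?_
  filter_upwards [eventually_ge_atTop 1] with k hk
  have hk' : (1 : ℝ) ≤ k := by exact_mod_cast hk
  have hk0 : (0 : ℝ) < k := by linarith
  have hkq : (k : ℝ) + -q ≠ 0 := by linarith
  have hw : glWeight q k = (∏ j ∈ Finset.range k, (-q + (j : ℝ))) / (Nat.factorial k : ℝ) := by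
    have hp : ∏ j ∈ Finset.range k, (-q + (j : ℝ))
        = (-1) ^ k * ∏ j ∈ Finset.range k, (q - (j : ℝ)) := by
      rw [← Finset.card_range k, ← Finset.prod_const, Finset.card_range,
        ← Finset.prod_mul_distrib]
      exact Finset.prod_congr rfl fun j _ => by ring
    rw [hp, glWeight, genBinom, mul_div_assoc]
  have hr : (0 : ℝ) < (k : ℝ) ^ (q + 1) := Real.rpow_pos_of_pos hk0 _
  rw [← abs_of_pos hr, ← abs_mul]
  congr 1
  have hkq' : -q + (k : ℝ) ≠ 0 := by linarith
  have hf : (Nat.factorial k : ℝ) ≠ 0 := by positivity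
  have hrq : (k : ℝ) ^ q ≠ 0 := (Real.rpow_pos_of_pos hk0 _).ne'
  rw [hw, Real.GammaSeq, Finset.prod_range_succ, Real.rpow_neg hk0.le, Real.rpow_add hk0,
    Real.rpow_one, add_comm (k : ℝ) (-q)]
  field_simp
end
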